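/- Let X = [−1,1] with the Euclidean metric, let P(X) be the smallest d-structure containing the paths γ1(t) = t and γ2(t) = −t, and let X* be the reversed d-space. Then the distortion distance satisfies d_dis(X, X*) = 1/2. -/

import Mathlib

open scoped ENNReal

noncomputable section

/-- The length of a path `γ : ℝ → X`: its total variation on `[0,1]`. -/
def pathLen {X : Type*} [PseudoEMetricSpace X] (γ : ℝ → X) : ℝ≥0∞ :=
  eVariationOn γ (Set.Icc 0 1)

/-- `P` is a d-space structure on `X`: it contains all constant paths, is closed under
precomposition with continuous nondecreasing maps `[0,1] → [0,1]`, and is closed under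
concatenation; all members are continuous on `[0,1]`. -/
structure IsDSpace {X : Type*} [MetricSpace X] (P : Set (ℝ → X)) : Prop where
  cont : ∀ γ ∈ P, ContinuousOn γ (Set.Icc (0:ℝ) 1)
  const_mem : ∀ x : X, (fun _ : ℝ => x) ∈ P
  reparam : ∀ γ ∈ P, ∀ h : ℝ → ℝ, ContinuousOn h (Set.Icc (0:ℝ) 1) →
    MonotoneOn h (Set.Icc (0:ℝ) 1) → Set.MapsTo h (Set.Icc (0:ℝ) 1) (Set.Icc (0:ℝ) 1) →
    γ ∘ h ∈ P
  concat : ∀ γ ∈ P, ∀ γ' ∈ P, γ 1 = γ' 0 →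
    (fun t : ℝ => if t ≤ 1/2 then γ (2*t) else γ' (2*t - 1)) ∈ P

/-- A d-structure is rectifiable if every d-path has finite length. -/
def IsRectifiable {X : Type*} [MetricSpace X] (P : Set (ℝ → X)) : Prop :=
  ∀ γ ∈ P, pathLen γ ≠ ⊤

/-- `γ` is a d-path from `x` to `x'`. -/
def IsDPathFrom {X : Type*} (P : Set (ℝ → X)) (x x' : X) (γ : ℝ → X) : Prop :=
  γ ∈ P ∧ γ 0 = x ∧ γ 1 = x'

/-- `L` is a zigzag path between `x` and `x'`: a finite sequence of d-paths, each joining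
consecutive points `p i`, `p (i+1)` in one direction or the other. -/
def IsZigzagFrom {X : Type*} (P : Set (ℝ → X)) (x x' : X) (L : List (ℝ → X)) : Prop :=
  ∃ p : ℕ → X, p 0 = x ∧ p L.length = x' ∧
    ∀ i : Fin L.length,
      IsDPathFrom P (p i) (p (i + 1)) (L.get i) ∨ IsDPathFrom P (p (i + 1)) (p i) (L.get i)

/-- The length of a zigzag path: the sum of the lengths of its pieces. -/
def zigzagLen {X : Type*} [PseudoEMetricSpace X] (L : List (ℝ → X)) : ℝ≥0∞ :=
  (L.map pathLen).sum

/-- The zigzag (extended) distance induced by a d-structure `P`. -/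
def zzDist {X : Type*} [MetricSpace X] (P : Set (ℝ → X)) (x x' : X) : ℝ≥0∞ :=
  ⨅ L ∈ {L : List (ℝ → X) | IsZigzagFrom P x x' L}, zigzagLen L

/-- Any two points are joined by a zigzag path. -/
def ZigzagConnected {X : Type*} (P : Set (ℝ → X)) : Prop :=
  ∀ x x' : X, ∃ L, IsZigzagFrom P x x' L

/-- A d-map: continuous and sending d-paths to d-paths. -/
def IsDMap {X Y : Type*} [MetricSpace X] [MetricSpace Y]
    (PX : Set (ℝ → X)) (PY : Set (ℝ → Y)) (F : X → Y) : Prop :=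
  Continuous F ∧ ∀ γ ∈ PX, F ∘ γ ∈ PY

/-- The reversed d-structure: `γ ∈ reverseP P` iff `t ↦ γ (1 - t)` belongs to `P`. -/
def reverseP {X : Type*} (P : Set (ℝ → X)) : Set (ℝ → X) :=
  {γ | (fun t => γ (1 - t)) ∈ P}

/-- `|a - b|` for extended nonnegative reals. -/
def ediffAbs (a b : ℝ≥0∞) : ℝ≥0∞ := (a - b) ⊔ (b - a)

/-- Distortion of a map with respect to extended distances on source and target. -/
def edis {X Y : Type*} (dX : X → X → ℝ≥0∞) (dY : Y → Y → ℝ≥0∞) (F : X → Y) : ℝ≥0∞ :=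
  ⨆ x : X, ⨆ x' : X, ediffAbs (dX x x') (dY (F x) (F x'))

/-- Codistortion of a pair of maps with respect to extended distances. -/
def ecodis {X Y : Type*} (dX : X → X → ℝ≥0∞) (dY : Y → Y → ℝ≥0∞)
    (F : X → Y) (G : Y → X) : ℝ≥0∞ :=
  ⨆ x : X, ⨆ y : Y, ediffAbs (dX x (G y)) (dY (F x) y)

/-- The distortion distance between two d-spaces: half the infimum, over pairs of d-maps,
of the maximum of the two distortions and the codistortion (w.r.t. zigzag distances). -/
def ddis {X Y : Type*} [MetricSpace X] [MetricSpace Y]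
    (PX : Set (ℝ → X)) (PY : Set (ℝ → Y)) : ℝ≥0∞ :=
  (1/2 : ℝ≥0∞) * ⨅ (F : {F : X → Y // IsDMap PX PY F}) (G : {G : Y → X // IsDMap PY PX G}),
    max (edis (zzDist PX) (zzDist PY) F.1)
      (max (edis (zzDist PY) (zzDist PX) G.1) (ecodis (zzDist PX) (zzDist PY) F.1 G.1))

/-- A d-correspondence: a relation with surjective projections that matches reachability. -/
def IsDCorrespondence {X Y : Type*} (PX : Set (ℝ → X)) (PY : Set (ℝ → Y))
    (R : Set (X × Y)) : Prop :=
  (∀ x : X, ∃ y : Y, (x, y) ∈ R) ∧ (∀ y : Y, ∃ x : X, (x, y) ∈ R) ∧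
  ∀ p ∈ R, ∀ q ∈ R,
    ((∃ γ, IsDPathFrom PX p.1 q.1 γ) ↔ (∃ γ, IsDPathFrom PY p.2 q.2 γ))

/-- Distortion of a correspondence with respect to the zigzag distances. -/
def corDis {X Y : Type*} [MetricSpace X] [MetricSpace Y]
    (PX : Set (ℝ → X)) (PY : Set (ℝ → Y)) (R : Set (X × Y)) : ℝ≥0∞ :=
  ⨆ p : R, ⨆ q : R, ediffAbs (zzDist PX p.1.1 q.1.1) (zzDist PY p.1.2 q.1.2)

/-- The d-correspondence distortion distance. -/
def dcdis {X Y : Type*} [MetricSpace X] [MetricSpace Y]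
    (PX : Set (ℝ → X)) (PY : Set (ℝ → Y)) : ℝ≥0∞ :=
  (1/2 : ℝ≥0∞) * ⨅ R : {R : Set (X × Y) // IsDCorrespondence PX PY R}, corDis PX PY R.1

/-- Hausdorff distance between two subsets w.r.t. an extended distance. -/
def ehausdorffDist {Z : Type*} (d : Z → Z → ℝ≥0∞) (s t : Set Z) : ℝ≥0∞ :=
  max (⨆ a ∈ s, ⨅ b ∈ t, d a b) (⨆ b ∈ t, ⨅ a ∈ s, d a b)

/-- The interval `[-1, 1]` with the Euclidean metric. -/
abbrev MInt : Type := {x : ℝ // x ∈ Set.Icc (-1:ℝ) 1}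

/-- Clamp a real number into `[-1, 1]`. -/
def clampM (t : ℝ) : MInt :=
  ⟨max (-1) (min 1 t), ⟨le_max_left _ _, max_le (by norm_num) (min_le_left _ _)⟩⟩

/-- The path `γ₁(t) = t` (for `t ∈ [0,1]`). -/
def gone : ℝ → MInt := fun t => clampM t

/-- The path `γ₂(t) = -t` (for `t ∈ [0,1]`). -/
def gtwo : ℝ → MInt := fun t => clampM (-t)

/-- The smallest d-structure on `[-1,1]` containing `γ₁` and `γ₂`: the intersection of all
d-structures containing them. -/
def mintP : Set (ℝ → MInt) :=
  ⋂₀ {P : Set (ℝ → MInt) | IsDSpace P ∧ {gone, gtwo} ⊆ P}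

/-- The paths on `[-1,1]` that move away from `0`, either to the right or to the left. -/
def outwardP : Set (ℝ → MInt) :=
  {γ | ContinuousOn γ (Set.Icc (0:ℝ) 1) ∧
    ((MonotoneOn γ (Set.Icc (0:ℝ) 1) ∧ 0 ≤ (γ 0).1) ∨
      (AntitoneOn γ (Set.Icc (0:ℝ) 1) ∧ (γ 0).1 ≤ 0))}

theorem clampM_coe (x : MInt) : clampM x.1 = x := by
  apply Subtype.ext
  have := x.2.1
  have := x.2.2
  simp [clampM, *]

theorem coe_clampM {t : ℝ} (h : t ∈ Set.Icc (-1:ℝ) 1) : (clampM t).1 = t :=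
  congrArg Subtype.val (clampM_coe ⟨t, h⟩)

theorem continuous_clampM : Continuous clampM := by
  unfold clampM
  fun_prop

theorem monotone_clampM : Monotone clampM := fun _ _ h =>
  Subtype.mk_le_mk.2 (max_le_max le_rfl (min_le_min le_rfl h))

theorem continuousOn_concat {X : Type*} [TopologicalSpace X] {γ γ' : ℝ → X}
    (h : ContinuousOn γ (Set.Icc (0:ℝ) 1)) (h' : ContinuousOn γ' (Set.Icc (0:ℝ) 1))
    (e : γ 1 = γ' 0) :
    ContinuousOn (fun t : ℝ => if t ≤ 1/2 then γ (2*t) else γ' (2*t - 1))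
      (Set.Icc (0:ℝ) 1) := by
  apply ContinuousOn.if
  · rintro a ⟨-, ha⟩
    have ha : a ∈ frontier (Set.Iic (1/2 : ℝ)) := ha
    rw [frontier_Iic] at ha
    rw [Set.mem_singleton_iff.1 ha]
    norm_num [e]
  · have hc : closure {t : ℝ | t ≤ 1/2} = Set.Iic (1/2) := isClosed_Iic.closure_eq
    rw [hc]
    refine h.comp (by fun_prop) ?_
    rintro t ⟨⟨h0, -⟩, ht⟩
    have ht : t ≤ 1/2 := ht
    constructor <;> linarith
  · have hc : closure {t : ℝ | ¬ t ≤ 1/2} = Set.Ici (1/2) := by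
      simp only [not_le]
      exact closure_Ioi _
    rw [hc]
    refine h'.comp (by fun_prop) ?_
    rintro t ⟨⟨-, h1⟩, ht⟩
    have ht : 1/2 ≤ t := ht
    constructor <;> linarith

theorem monotoneOn_concat {X : Type*} [Preorder X] {γ γ' : ℝ → X}
    (h : MonotoneOn γ (Set.Icc (0:ℝ) 1)) (h' : MonotoneOn γ' (Set.Icc (0:ℝ) 1))
    (e : γ 1 = γ' 0) :
    MonotoneOn (fun t : ℝ => if t ≤ 1/2 then γ (2*t) else γ' (2*t - 1))
      (Set.Icc (0:ℝ) 1) := by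
  rintro s ⟨hs0, hs1⟩ t ⟨ht0, ht1⟩ hst
  dsimp only
  split_ifs with hs ht ht
  · exact h ⟨by linarith, by linarith⟩ ⟨by linarith, by linarith⟩ (by linarith)
  · push Not at ht
    calc γ (2*s) ≤ γ 1 := h ⟨by linarith, by linarith⟩ ⟨by linarith, by linarith⟩ (by linarith)
      _ = γ' 0 := e
      _ ≤ γ' (2*t-1) := h' ⟨by linarith, by linarith⟩ ⟨by linarith, by linarith⟩ (by linarith)
  · linarith
  · push Not at hs ht
    exact h' ⟨by linarith, by linarith⟩ ⟨by linarith, by linarith⟩ (by linarith)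

theorem antitoneOn_concat {X : Type*} [Preorder X] {γ γ' : ℝ → X}
    (h : AntitoneOn γ (Set.Icc (0:ℝ) 1)) (h' : AntitoneOn γ' (Set.Icc (0:ℝ) 1))
    (e : γ 1 = γ' 0) :
    AntitoneOn (fun t : ℝ => if t ≤ 1/2 then γ (2*t) else γ' (2*t - 1))
      (Set.Icc (0:ℝ) 1) :=
  monotoneOn_concat (X := Xᵒᵈ) h h' e

theorem constantOn_of_monotoneOn {γ : ℝ → MInt} (h : MonotoneOn γ (Set.Icc (0:ℝ) 1))
    (h01 : (γ 1).1 ≤ (γ 0).1) {t : ℝ} (ht : t ∈ Set.Icc (0:ℝ) 1) : γ t = γ 1 :=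
  le_antisymm (h ht ⟨zero_le_one, le_rfl⟩ ht.2)
    (le_trans h01 (h ⟨le_rfl, zero_le_one⟩ ht ht.1))

theorem constantOn_of_antitoneOn {γ : ℝ → MInt} (h : AntitoneOn γ (Set.Icc (0:ℝ) 1))
    (h01 : (γ 0).1 ≤ (γ 1).1) {t : ℝ} (ht : t ∈ Set.Icc (0:ℝ) 1) : γ t = γ 1 :=
  le_antisymm (le_trans (h ⟨le_rfl, zero_le_one⟩ ht ht.1) h01)
    (h ht ⟨zero_le_one, le_rfl⟩ ht.2)

theorem isDSpace_outwardP : IsDSpace outwardP where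
  cont _ h := h.1
  const_mem x := ⟨continuousOn_const, (le_total 0 x.1).imp
    (fun h => ⟨fun _ _ _ _ _ => le_rfl, h⟩) (fun h => ⟨fun _ _ _ _ _ => le_rfl, h⟩)⟩
  reparam γ hγ h hc hm hmaps := by
    have h0 : (0:ℝ) ∈ Set.Icc (0:ℝ) 1 := ⟨le_rfl, zero_le_one⟩
    refine ⟨hγ.1.comp hc hmaps, hγ.2.imp (fun k => ⟨k.1.comp hm hmaps, ?_⟩)
      (fun k => ⟨k.1.comp_MonotoneOn hm hmaps, ?_⟩)⟩
    · exact k.2.trans (k.1 h0 (hmaps h0) (hmaps h0).1)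
    · exact le_trans (k.1 h0 (hmaps h0) (hmaps h0).1) k.2
  concat γ hγ γ' hγ' e := by
    have h0 : (0:ℝ) ∈ Set.Icc (0:ℝ) 1 := ⟨le_rfl, zero_le_one⟩
    have h1 : (1:ℝ) ∈ Set.Icc (0:ℝ) 1 := ⟨zero_le_one, le_rfl⟩
    refine ⟨continuousOn_concat hγ.1 hγ'.1 e, ?_⟩
    have hz : (if (0:ℝ) ≤ 1/2 then γ (2*0) else γ' (2*0-1)) = γ 0 := by norm_num
    simp only [hz]
    rcases hγ.2 with ⟨m, s⟩ | ⟨m, s⟩ <;> rcases hγ'.2 with ⟨m', s'⟩ | ⟨m', s'⟩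
    · exact Or.inl ⟨monotoneOn_concat m m' e, s⟩
    · have hle : (γ 1).1 ≤ (γ 0).1 := by rw [e]; exact s'.trans s
      have hc := fun t (ht : t ∈ Set.Icc (0:ℝ) 1) => constantOn_of_monotoneOn m hle ht
      refine Or.inr ⟨antitoneOn_concat (fun a ha b hb _ => (hc a ha ▸ hc b hb).le) m' e, ?_⟩
      rw [hc 0 h0, e]
      exact s'
    · have hle : (γ 0).1 ≤ (γ 1).1 := by rw [e]; exact s.trans s'
      have hc := fun t (ht : t ∈ Set.Icc (0:ℝ) 1) => constantOn_of_antitoneOn m hle ht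
      refine Or.inl ⟨monotoneOn_concat (fun a ha b hb _ => (hc a ha ▸ hc b hb).ge) m' e, ?_⟩
      rw [hc 0 h0, e]
      exact s'
    · exact Or.inr ⟨antitoneOn_concat m m' e, s⟩

theorem gone_mem_outwardP : gone ∈ outwardP :=
  ⟨continuous_clampM.continuousOn,
    Or.inl ⟨monotone_clampM.monotoneOn _, by simp [gone, clampM]⟩⟩

theorem gtwo_mem_outwardP : gtwo ∈ outwardP :=
  ⟨(continuous_clampM.comp continuous_neg).continuousOn,
    Or.inr ⟨fun _ _ _ _ h => monotone_clampM (neg_le_neg h), by simp [gtwo, clampM]⟩⟩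

theorem mintP_eq_outwardP : mintP = outwardP := by
  apply Set.Subset.antisymm
  · apply Set.sInter_subset_of_mem
    refine ⟨isDSpace_outwardP, ?_⟩
    rintro γ (rfl | rfl)
    exacts [gone_mem_outwardP, gtwo_mem_outwardP]
  · rintro γ ⟨hc, hγ⟩ P ⟨hP, hsub⟩
    have h0 : (0:ℝ) ∈ Set.Icc (0:ℝ) 1 := ⟨le_rfl, zero_le_one⟩
    have hv : ContinuousOn (fun t => (γ t).1) (Set.Icc (0:ℝ) 1) :=
      continuous_subtype_val.comp_continuousOn hc
    rcases hγ with ⟨m, s⟩ | ⟨m, s⟩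
    · have e : gone ∘ (fun t => (γ t).1) = γ := funext fun t => clampM_coe (γ t)
      rw [← e]
      exact hP.reparam _ (hsub (Or.inl rfl)) _ hv m
        fun t ht => ⟨le_trans s (m h0 ht ht.1), (γ t).2.2⟩
    · have e : gtwo ∘ (fun t => -(γ t).1) = γ := funext fun t => by
        simp [gtwo, clampM_coe]
      rw [← e]
      exact hP.reparam _ (hsub (Or.inr rfl)) _ hv.neg
        (fun a ha b hb hab => neg_le_neg (m ha hb hab))
        fun t ht => ⟨neg_nonneg.2 (le_trans (m h0 ht ht.1) s), neg_le.1 (γ t).2.1⟩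

/-- The affine path from `x` to `y`. -/
def affinePath (x y : MInt) : ℝ → MInt := fun t => clampM (x.1 + t * (y.1 - x.1))

theorem affinePath_zero (x y : MInt) : affinePath x y 0 = x := by
  simp [affinePath, clampM_coe]

theorem affinePath_one (x y : MInt) : affinePath x y 1 = y := by
  simp [affinePath, clampM_coe]

theorem affinePath_reverse (x y : MInt) :
    (fun t => affinePath x y (1 - t)) = affinePath y x := by
  funext t
  simp only [affinePath]
  congr 1
  ring

theorem coe_affinePath (x y : MInt) {t : ℝ} (ht : t ∈ Set.Icc (0:ℝ) 1) :
    (affinePath x y t).1 = x.1 + t * (y.1 - x.1) := by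
  apply coe_clampM
  have := (convex_Icc (-1:ℝ) 1).add_smul_sub_mem x.2 y.2 ht
  simpa using this

theorem affinePath_mem_outwardP {x y : MInt}
    (h : (0 ≤ x.1 ∧ x.1 ≤ y.1) ∨ (x.1 ≤ 0 ∧ y.1 ≤ x.1)) : affinePath x y ∈ outwardP := by
  refine ⟨(continuous_clampM.comp (by fun_prop)).continuousOn, ?_⟩
  rw [affinePath_zero]
  refine h.imp (fun h => ⟨fun s _ t _ hst => monotone_clampM ?_, h.1⟩)
    (fun h => ⟨fun s _ t _ hst => monotone_clampM ?_, h.1⟩)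
  · nlinarith
  · nlinarith

theorem affinePath_mem_outwardP_or {x y : MInt} (h : 0 ≤ x.1 * y.1) :
    affinePath x y ∈ outwardP ∨ affinePath y x ∈ outwardP := by
  rcases mul_nonneg_iff.1 h with ⟨hx, hy⟩ | ⟨hx, hy⟩ <;> rcases le_total x.1 y.1 with k | k
  · exact Or.inl (affinePath_mem_outwardP (Or.inl ⟨hx, k⟩))
  · exact Or.inr (affinePath_mem_outwardP (Or.inl ⟨hy, k⟩))
  · exact Or.inr (affinePath_mem_outwardP (Or.inr ⟨hy, k⟩))
  · exact Or.inl (affinePath_mem_outwardP (Or.inr ⟨hx, k⟩))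

theorem pathLen_affinePath_le (x y : MInt) : pathLen (affinePath x y) ≤ edist x y := by
  have hl : LipschitzOnWith (nndist x y) (affinePath x y) (Set.Icc (0:ℝ) 1) := by
    apply LipschitzOnWith.of_dist_le_mul
    intro s hs t ht
    rw [Subtype.dist_eq, coe_affinePath x y hs, coe_affinePath x y ht, Real.dist_eq,
      coe_nndist, Subtype.dist_eq, Real.dist_eq, Real.dist_eq, abs_sub_comm x.1 y.1, ← abs_mul]
    apply le_of_eq
    congr 1
    ring
  have hid : eVariationOn (id : ℝ → ℝ) (Set.Icc (0:ℝ) 1) ≤ 1 := by simp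
  calc pathLen (affinePath x y)
      ≤ (nndist x y : ℝ≥0∞) * eVariationOn (id : ℝ → ℝ) (Set.Icc (0:ℝ) 1) :=
        hl.comp_eVariationOn_le (g := id) (fun _ h => h)
    _ ≤ (nndist x y : ℝ≥0∞) * 1 := by gcongr
    _ = edist x y := by rw [mul_one, edist_nndist]

theorem edist_le_pathLen {X : Type*} [PseudoEMetricSpace X] (γ : ℝ → X) :
    edist (γ 0) (γ 1) ≤ pathLen γ :=
  eVariationOn.edist_le γ ⟨le_rfl, zero_le_one⟩ ⟨zero_le_one, le_rfl⟩

theorem edist_le_zzDist {X : Type*} [MetricSpace X] (P : Set (ℝ → X)) (x y : X) :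
    edist x y ≤ zzDist P x y := by
  refine le_iInf₂ fun L hL => ?_
  obtain ⟨p, rfl, rfl, hp⟩ := hL
  calc edist (p 0) (p L.length)
      ≤ ∑ i ∈ Finset.range L.length, edist (p i) (p (i + 1)) := edist_le_range_sum_edist p _
    _ = ∑ i : Fin L.length, edist (p i) (p (i + 1)) :=
        (Fin.sum_univ_eq_sum_range (fun i => edist (p i) (p (i + 1))) _).symm
    _ ≤ ∑ i : Fin L.length, pathLen (L.get i) := by
        refine Finset.sum_le_sum fun i _ => ?_
        rcases hp i with ⟨-, h0, h1⟩ | ⟨-, h0, h1⟩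
        · rw [← h0, ← h1]
          exact edist_le_pathLen _
        · rw [← h0, ← h1, edist_comm]
          exact edist_le_pathLen _
    _ = zigzagLen L := by
        rw [zigzagLen, ← Fin.sum_univ_fun_getElem L pathLen]
        rfl

theorem zzDist_triangle_of_affinePath {P : Set (ℝ → MInt)} {x m y : MInt}
    (h : affinePath x m ∈ P ∨ affinePath m x ∈ P)
    (h' : affinePath m y ∈ P ∨ affinePath y m ∈ P) :
    zzDist P x y ≤ edist x m + edist m y := by
  have piece : ∀ a b : MInt, (affinePath a b ∈ P ∨ affinePath b a ∈ P) →
      ∃ γ, (IsDPathFrom P a b γ ∨ IsDPathFrom P b a γ) ∧ pathLen γ ≤ edist a b := by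
    rintro a b (h | h)
    · exact ⟨_, Or.inl ⟨h, affinePath_zero a b, affinePath_one a b⟩, pathLen_affinePath_le a b⟩
    · exact ⟨_, Or.inr ⟨h, affinePath_zero b a, affinePath_one b a⟩,
        edist_comm a b ▸ pathLen_affinePath_le b a⟩
  obtain ⟨γ, hγ, lγ⟩ := piece x m h
  obtain ⟨δ, hδ, lδ⟩ := piece m y h'
  refine (iInf₂_le [γ, δ] ?_).trans ?_
  · refine ⟨fun i => if i = 0 then x else if i = 1 then m else y, by simp, by simp, ?_⟩
    intro i
    fin_cases i
    · simpa using hγ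
    · simpa using hδ
  · simpa [zigzagLen] using add_le_add lγ lδ

theorem zzDist_eq_edist {P : Set (ℝ → MInt)}
    (hP : ∀ x y : MInt, 0 ≤ x.1 * y.1 → affinePath x y ∈ P ∨ affinePath y x ∈ P) :
    zzDist P = edist := by
  funext x y
  refine le_antisymm ?_ (edist_le_zzDist P x y)
  rcases le_total 0 (x.1 * y.1) with h | h
  · simpa using zzDist_triangle_of_affinePath (hP x y h) (hP y y (mul_self_nonneg _))
  · let o : MInt := ⟨0, by norm_num, by norm_num⟩
    refine (zzDist_triangle_of_affinePath (m := o) (hP x o (by simp [o]))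
      (hP o y (by simp [o]))).trans (le_of_eq ?_)
    rw [edist_dist, edist_dist, edist_dist, ← ENNReal.ofReal_add dist_nonneg dist_nonneg]
    congr 1
    simp only [Subtype.dist_eq, Real.dist_eq, o, sub_zero, zero_sub, abs_neg]
    rcases mul_nonpos_iff.1 h with ⟨hx, hy⟩ | ⟨hx, hy⟩
    · rw [abs_of_nonneg hx, abs_of_nonpos hy, abs_of_nonneg (by linarith)]
      ring
    · rw [abs_of_nonpos hx, abs_of_nonneg hy, abs_of_nonpos (by linarith)]
      ring

theorem zzDist_mintP : zzDist mintP = edist :=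
  zzDist_eq_edist fun _ _ h => mintP_eq_outwardP ▸ affinePath_mem_outwardP_or h

theorem zzDist_reverseP_mintP : zzDist (reverseP mintP) = edist := by
  refine zzDist_eq_edist fun x y h => ?_
  simp only [reverseP, Set.mem_ofPred_eq, affinePath_reverse, mintP_eq_outwardP]
  exact (affinePath_mem_outwardP_or h).symm

theorem ediffAbs_edist_le_one {X Y : Type*} [PseudoMetricSpace X] [PseudoMetricSpace Y]
    {x x' : X} {y y' : Y} (h : |dist x x' - dist y y'| ≤ 1) :
    ediffAbs (edist x x') (edist y y') ≤ 1 := by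
  rw [abs_le] at h
  rw [edist_dist, edist_dist]
  refine sup_le ?_ ?_ <;>
  · rw [← ENNReal.ofReal_sub _ dist_nonneg]
    exact ENNReal.ofReal_le_one.2 (by linarith)

/-- The d-map `X → X*` collapsing the right half of the interval to `1`. -/
def collapseRight (x : MInt) : MInt :=
  ⟨1 + min x.1 0, by have := le_min x.2.1 (by norm_num : (-1:ℝ) ≤ 0); linarith,
    by have := min_le_right x.1 0; linarith⟩

/-- The d-map `X* → X` collapsing the left half of the interval to `-1`. -/
def collapseLeft (x : MInt) : MInt :=
  ⟨-1 + max x.1 0, by have := le_max_right x.1 0; linarith,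
    by have := max_le x.2.2 (by norm_num : (0:ℝ) ≤ 1); linarith⟩

theorem monotone_collapseRight : Monotone collapseRight := fun _ _ h =>
  Subtype.mk_le_mk.2 (add_le_add_right (min_le_min (Subtype.coe_le_coe.2 h) le_rfl) (1:ℝ))

theorem monotone_collapseLeft : Monotone collapseLeft := fun _ _ h =>
  Subtype.mk_le_mk.2 (add_le_add_right (max_le_max (Subtype.coe_le_coe.2 h) le_rfl) (-1:ℝ))

theorem continuous_collapseRight : Continuous collapseRight := by
  unfold collapseRight
  fun_prop

theorem continuous_collapseLeft : Continuous collapseLeft := by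
  unfold collapseLeft
  fun_prop

theorem mem_reverseP_mintP {γ : ℝ → MInt} :
    γ ∈ reverseP mintP ↔ ContinuousOn γ (Set.Icc (0:ℝ) 1) ∧
      ((AntitoneOn γ (Set.Icc (0:ℝ) 1) ∧ 0 ≤ (γ 1).1) ∨
        (MonotoneOn γ (Set.Icc (0:ℝ) 1) ∧ (γ 1).1 ≤ 0)) := by
  have maps : Set.MapsTo (fun t : ℝ => 1 - t) (Set.Icc 0 1) (Set.Icc 0 1) :=
    fun t ht => ⟨sub_nonneg.2 ht.2, sub_le_self _ ht.1⟩
  have anti : AntitoneOn (fun t : ℝ => 1 - t) (Set.Icc 0 1) :=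
    fun a _ b _ h => sub_le_sub_left h 1
  have cont : ContinuousOn (fun t : ℝ => 1 - t) (Set.Icc 0 1) := by fun_prop
  have e : γ = (fun t => γ (1 - t)) ∘ (fun t => 1 - t) := by
    funext t
    simp
  simp only [reverseP, Set.mem_ofPred_eq, mintP_eq_outwardP, outwardP, sub_zero]
  constructor
  · rintro ⟨c, h⟩
    refine ⟨e ▸ c.comp cont maps, h.imp (fun h => ⟨?_, h.2⟩) (fun h => ⟨?_, h.2⟩)⟩
    · exact e ▸ h.1.comp_AntitoneOn anti maps
    · exact e ▸ h.1.comp anti maps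
  · rintro ⟨c, h⟩
    refine ⟨c.comp cont maps, h.imp (fun h => ⟨?_, h.2⟩) (fun h => ⟨?_, h.2⟩)⟩
    · exact h.1.comp anti maps
    · exact h.1.comp_AntitoneOn anti maps

theorem isDMap_collapseRight : IsDMap mintP (reverseP mintP) collapseRight := by
  refine ⟨continuous_collapseRight, fun γ hγ => ?_⟩
  rw [mintP_eq_outwardP] at hγ
  obtain ⟨c, h⟩ := hγ
  refine mem_reverseP_mintP.2 ⟨continuous_collapseRight.comp_continuousOn c, Or.inl ⟨?_, ?_⟩⟩
  · rcases h with ⟨m, s⟩ | ⟨m, s⟩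
    · intro a ha b hb _
      refine Subtype.mk_le_mk.2 (add_le_add_right ?_ 1)
      have : (0:ℝ) ≤ (γ a).1 := s.trans (m ⟨le_rfl, zero_le_one⟩ ha ha.1)
      exact le_min ((min_le_right _ _).trans this) (min_le_right _ _)
    · exact monotone_collapseRight.comp_antitoneOn m
  · have := le_min (γ 1).2.1 (by norm_num : (-1:ℝ) ≤ 0)
    simp only [Function.comp, collapseRight]
    linarith

theorem isDMap_collapseLeft : IsDMap (reverseP mintP) mintP collapseLeft := by
  refine ⟨continuous_collapseLeft, fun γ hγ => ?_⟩
  obtain ⟨c, h⟩ := mem_reverseP_mintP.1 hγ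
  rw [mintP_eq_outwardP]
  refine ⟨continuous_collapseLeft.comp_continuousOn c, Or.inr ⟨?_, ?_⟩⟩
  · rcases h with ⟨m, s⟩ | ⟨m, s⟩
    · exact monotone_collapseLeft.comp_antitoneOn m
    · intro a ha b hb _
      refine Subtype.mk_le_mk.2 (add_le_add_right ?_ (-1))
      have : (γ b).1 ≤ 0 := le_trans (m hb ⟨zero_le_one, le_rfl⟩ hb.2) s
      exact max_le (this.trans (le_max_right _ _)) (le_max_right _ _)
  · have := max_le (γ 0).2.2 (by norm_num : (0:ℝ) ≤ 1)
    simp only [Function.comp, collapseLeft]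
    linarith

theorem edis_collapseRight_le : edis edist edist collapseRight ≤ 1 := by
  refine iSup₂_le fun x y => ediffAbs_edist_le_one ?_
  obtain ⟨x, hx, hx'⟩ := x
  obtain ⟨y, hy, hy'⟩ := y
  simp only [Subtype.dist_eq, Real.dist_eq, collapseRight]
  grind

theorem edis_collapseLeft_le : edis edist edist collapseLeft ≤ 1 := by
  refine iSup₂_le fun x y => ediffAbs_edist_le_one ?_
  obtain ⟨x, hx, hx'⟩ := x
  obtain ⟨y, hy, hy'⟩ := y
  simp only [Subtype.dist_eq, Real.dist_eq, collapseLeft]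
  grind

theorem ecodis_collapse_le : ecodis edist edist collapseRight collapseLeft ≤ 1 := by
  refine iSup₂_le fun x y => ediffAbs_edist_le_one ?_
  obtain ⟨x, hx, hx'⟩ := x
  obtain ⟨y, hy, hy'⟩ := y
  simp only [Subtype.dist_eq, Real.dist_eq, collapseRight, collapseLeft]
  grind

theorem one_le_edis {F : MInt → MInt} (hF : IsDMap mintP (reverseP mintP) F) :
    1 ≤ edis edist edist F := by
  have h0 : (0:ℝ) ∈ Set.Icc (0:ℝ) 1 := ⟨le_rfl, zero_le_one⟩
  have h1 : (1:ℝ) ∈ Set.Icc (0:ℝ) 1 := ⟨zero_le_one, le_rfl⟩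
  have key : ∀ γ ∈ outwardP,
      (0 ≤ (F (γ 1)).1 ∧ (F (γ 1)).1 ≤ (F (γ 0)).1) ∨
        ((F (γ 1)).1 ≤ 0 ∧ (F (γ 0)).1 ≤ (F (γ 1)).1) := by
    intro γ hγ
    have := (mem_reverseP_mintP.1 (hF.2 γ (mintP_eq_outwardP ▸ hγ))).2
    exact this.imp (fun h => ⟨h.2, h.1 h0 h1 zero_le_one⟩)
      (fun h => ⟨h.2, h.1 h0 h1 zero_le_one⟩)
  have k1 := key _ gone_mem_outwardP
  have k2 := key _ gtwo_mem_outwardP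
  have e : gtwo 0 = gone 0 := by simp [gone, gtwo]
  rw [e] at k2
  have hle : edist (F (gone 1)) (F (gtwo 1)) ≤ 1 := by
    rw [edist_dist]
    refine ENNReal.ofReal_le_one.2 ?_
    have := (F (gone 0)).2.1
    have := (F (gone 0)).2.2
    rw [Subtype.dist_eq, Real.dist_eq, abs_le]
    rcases k1 with ⟨_, _⟩ | ⟨_, _⟩ <;> rcases k2 with ⟨_, _⟩ | ⟨_, _⟩ <;>
      constructor <;> linarith
  have h2 : edist (gone 1) (gtwo 1) = 2 := by
    rw [edist_dist, Subtype.dist_eq, Real.dist_eq, gone, gtwo, coe_clampM (by norm_num),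
      coe_clampM (by norm_num)]
    norm_num
  calc (1 : ℝ≥0∞) = 2 - 1 := by rw [← one_add_one_eq_two, ENNReal.add_sub_cancel_right ENNReal.one_ne_top]
    _ ≤ edist (gone 1) (gtwo 1) - edist (F (gone 1)) (F (gtwo 1)) := by
        rw [h2]
        exact tsub_le_tsub_left hle 2
    _ ≤ ediffAbs (edist (gone 1) (gtwo 1)) (edist (F (gone 1)) (F (gtwo 1))) := le_sup_left
    _ ≤ edis edist edist F :=
        le_iSup₂ (f := fun x y => ediffAbs (edist x y) (edist (F x) (F y))) (gone 1) (gtwo 1)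

/-- The distortion distance between `X = ([-1,1], ⟨γ₁, γ₂⟩)` and its
reversed d-space `X*` equals `1/2`. -/
theorem ddis_mint_reverse :
    ddis mintP (reverseP mintP) = (1/2 : ℝ≥0∞) := by
  rw [ddis, zzDist_mintP, zzDist_reverseP_mintP]
  have h : (⨅ (F : {F : MInt → MInt // IsDMap mintP (reverseP mintP) F})
      (G : {G : MInt → MInt // IsDMap (reverseP mintP) mintP G}),
      max (edis edist edist F.1) (max (edis edist edist G.1)
        (ecodis edist edist F.1 G.1))) = 1 := by
    refine le_antisymm ?_ (le_iInf₂ fun F _ => (one_le_edis F.2).trans (le_max_left _ _))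
    exact iInf_le_of_le ⟨collapseRight, isDMap_collapseRight⟩ <|
      iInf_le_of_le ⟨collapseLeft, isDMap_collapseLeft⟩
      (max_le edis_collapseRight_le (max_le edis_collapseLeft_le ecodis_collapse_le))
  rw [h, mul_one]

end
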